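/- arXiv:1508.02777 — 2 statements merged into one kernel-verified Lean document; each statement's English description precedes it below -/
import Mathlib

section
/- Two lattices a₁ ⊕ ⋯ ⊕ aₘ and b₁ ⊕ ⋯ ⊕ bₙ over a Dedekind domain R (with all aᵢ, bⱼ nonzero fractional ideals) are isomorphic as R-modules if and only if m = n and the products a₁⋯aₘ and b₁⋯bₙ lie in the same ideal class of R. -/
open scoped nonZeroDivisors

namespace FractionalIdeal

variable {R K : Type*} [CommRing R] [Field K] [Algebra R K]

/-- A pi type of fractional ideals, viewed as an `R`-module. -/
abbrev PiModule {ι : Type*} (a : ι → FractionalIdeal R⁰ K) : Type _ :=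
  (i : ι) → (a i : Submodule R K)

lemma matrix_mul_eq_one {ι κ : Type*} [Fintype ι] [Fintype κ] [DecidableEq ι]
    {a : ι → FractionalIdeal R⁰ K} {b : κ → FractionalIdeal R⁰ K} (ha : ∀ i, a i ≠ 0)
    {f : PiModule a → PiModule b} {g : PiModule b → PiModule a} (hgf : ∀ x, g (f x) = x)
    {T : Matrix κ ι K} (hT : ∀ x j, (f x j : K) = ∑ i, T j i * x i)
    {S : Matrix ι κ K} (hS : ∀ y i, (g y i : K) = ∑ j, S i j * y j) : S * T = 1 := by
  ext i k
  obtain ⟨e, he, he₀⟩ : ∃ e ∈ a k, e ≠ 0 := by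
    by_contra! h
    exact ha k (eq_zero_iff.mpr h)
  have h := hS (f (Pi.single k ⟨e, he⟩)) i
  simp only [hgf, hT, Finset.mul_sum] at h
  rw [Finset.sum_comm] at h
  rw [Finset.sum_eq_single k (fun l _ hl ↦ by simp [Pi.single_eq_of_ne hl]) (by simp)] at h
  simp only [Pi.single_eq_same, ← mul_assoc, ← Finset.sum_mul, ← Matrix.mul_apply] at h
  apply mul_right_cancel₀ he₀
  rw [← h, Matrix.one_apply]
  split_ifs with hik
  · subst hik; simp
  · simp [Pi.single_eq_of_ne hik]

variable [IsFractionRing R K]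

lemma spanSingleton_prod_mul_prod_le {ι : Type*} (s : Finset ι) (t : ι → K)
    (a b : ι → FractionalIdeal R⁰ K) (h : ∀ i, spanSingleton R⁰ (t i) * a i ≤ b i) :
    spanSingleton R⁰ (∏ i ∈ s, t i) * ∏ i ∈ s, a i ≤ ∏ i ∈ s, b i := by
  classical
  induction s using Finset.induction_on with
  | empty => simp
  | insert i s hi ih =>
    rw [Finset.prod_insert hi, Finset.prod_insert hi, Finset.prod_insert hi,
      ← spanSingleton_mul_spanSingleton, mul_mul_mul_comm]
    exact mul_le_mul' (h i) ih

lemma spanSingleton_det_mul_prod_le {ι : Type*} [Fintype ι] [DecidableEq ι]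
    (a b : ι → FractionalIdeal R⁰ K) (T : Matrix ι ι K)
    (hT : ∀ j i, spanSingleton R⁰ (T j i) * a i ≤ b j) :
    spanSingleton R⁰ T.det * ∏ i, a i ≤ ∏ i, b i := by
  refine spanSingleton_mul_le_iff.mpr fun z hz ↦ ?_
  rw [Matrix.det_apply, Finset.sum_mul]
  refine Submodule.sum_mem (∏ i, b i : FractionalIdeal R⁰ K).coeToSubmodule fun σ _ ↦ ?_
  have h := spanSingleton_mul_le_iff.mp (spanSingleton_prod_mul_prod_le Finset.univ
    (fun i ↦ T (σ i) i) a (fun i ↦ b (σ i)) fun i ↦ hT (σ i) i) z hz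
  rw [Equiv.prod_comp σ b] at h
  rcases Int.units_eq_one_or (Equiv.Perm.sign σ) with hσ | hσ
  · simpa [hσ] using h
  · simpa [hσ] using Submodule.neg_mem (∏ i, b i : FractionalIdeal R⁰ K).coeToSubmodule h

/-- Multiplication by `c` is an isomorphism of a fractional ideal onto its multiple by `c`. -/
theorem nonempty_linearEquiv_of_spanSingleton_mul_eq {a b : FractionalIdeal R⁰ K} {c : K}
    (hc : c ≠ 0) (h : spanSingleton R⁰ c * a = b) :
    Nonempty ((a : Submodule R K) ≃ₗ[R] (b : Submodule R K)) := by
  subst h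
  refine ⟨LinearEquiv.ofBijective ((LinearMap.mulLeft R c).restrict fun x hx ↦
    mem_singleton_mul.mpr ⟨x, hx, rfl⟩) ⟨fun x y hxy ↦ ?_, fun y ↦ ?_⟩⟩
  · exact Subtype.ext (mul_left_cancel₀ hc (congrArg Subtype.val hxy))
  · obtain ⟨x, hx, hy⟩ := mem_singleton_mul.mp y.2
    exact ⟨⟨x, hx⟩, Subtype.ext hy.symm⟩

section Matrix

variable [IsDomain R]

lemma exists_eq_mul_of_linearMap (a : Submodule R K) (f : a →ₗ[R] K) :
    ∃ t : K, ∀ x : a, f x = t * x := by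
  by_cases h : ∃ x : a, (x : K) ≠ 0
  · obtain ⟨x₀, hx₀⟩ := h
    refine ⟨f x₀ / x₀, fun x ↦ ?_⟩
    obtain ⟨s, r, hr, hsr⟩ := IsFractionRing.div_surjective (A := R) ((x : K) / x₀)
    have hr₀ : algebraMap R K r ≠ 0 :=
      IsFractionRing.to_map_ne_zero_of_mem_nonZeroDivisors hr
    have hx : r • x = s • x₀ := by
      ext
      rw [div_eq_div_iff hr₀ hx₀] at hsr
      simp only [Submodule.coe_smul, Algebra.smul_def, hsr, mul_comm]
    have hf := congrArg f hx
    rw [map_smul, map_smul, Algebra.smul_def, Algebra.smul_def] at hf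
    rw [div_mul_eq_mul_div, eq_div_iff hx₀]
    apply mul_left_cancel₀ hr₀
    rw [div_eq_div_iff hr₀ hx₀] at hsr
    linear_combination (x₀ : K) * hf + f x₀ * hsr
  · push Not at h
    refine ⟨0, fun x ↦ ?_⟩
    have : x = 0 := Subtype.ext (h x)
    simp [this]

/-- An `R`-linear map between direct sums of fractional ideals is given by a matrix over `K`. -/
lemma exists_matrix_of_linearMap {ι κ : Type*} [Fintype ι] [DecidableEq ι]
    {a : ι → FractionalIdeal R⁰ K} {b : κ → FractionalIdeal R⁰ K}
    (f : PiModule a →ₗ[R] PiModule b) :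
    ∃ T : Matrix κ ι K, (∀ j i, spanSingleton R⁰ (T j i) * a i ≤ b j) ∧
      ∀ x j, (f x j : K) = ∑ i, T j i * x i := by
  have h (j : κ) (i : ι) := exists_eq_mul_of_linearMap (a i : Submodule R K)
    ((b j : Submodule R K).subtype ∘ₗ LinearMap.proj j ∘ₗ f ∘ₗ LinearMap.single R (fun i ↦ (a i : Submodule R K)) i)
  choose T hT using h
  refine ⟨T, fun j i ↦ spanSingleton_mul_le_iff.mpr fun z hz ↦ ?_, fun x j ↦ ?_⟩
  · have := hT j i ⟨z, hz⟩
    dsimp at this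
    rw [← this]
    exact Subtype.prop _
  · conv_lhs => rw [← Finset.univ_sum_single x, map_sum, Finset.sum_apply]
    rw [Submodule.coe_sum]
    exact Finset.sum_congr rfl fun i _ ↦ hT j i (x i)

theorem exists_spanSingleton_mul_prod_eq_of_linearEquiv {ι : Type*} [Fintype ι]
    {a b : ι → FractionalIdeal R⁰ K} (ha : ∀ i, a i ≠ 0) (f : PiModule a ≃ₗ[R] PiModule b) :
    ∃ c : K, c ≠ 0 ∧ spanSingleton R⁰ c * ∏ i, a i = ∏ i, b i := by
  classical
  obtain ⟨T, hT, hfT⟩ := exists_matrix_of_linearMap f.toLinearMap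
  obtain ⟨S, hS, hfS⟩ := exists_matrix_of_linearMap f.symm.toLinearMap
  have hdet : T.det * S.det = 1 := by
    rw [mul_comm, ← Matrix.det_mul,
      matrix_mul_eq_one ha (fun x ↦ f.symm_apply_apply x) hfT hfS, Matrix.det_one]
  refine ⟨T.det, left_ne_zero_of_mul_eq_one hdet,
    le_antisymm (spanSingleton_det_mul_prod_le a b T hT) ?_⟩
  have h := mul_le_mul_right (spanSingleton_det_mul_prod_le b a S hS) (spanSingleton R⁰ T.det)
  rwa [← mul_assoc, spanSingleton_mul_spanSingleton, hdet, spanSingleton_one, one_mul] at h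

theorem card_eq_of_linearEquiv {ι κ : Type*} [Fintype ι] [Fintype κ]
    {a : ι → FractionalIdeal R⁰ K} {b : κ → FractionalIdeal R⁰ K}
    (ha : ∀ i, a i ≠ 0) (hb : ∀ j, b j ≠ 0) (f : PiModule a ≃ₗ[R] PiModule b) :
    Fintype.card ι = Fintype.card κ := by
  classical
  obtain ⟨T, -, hT⟩ := exists_matrix_of_linearMap f.toLinearMap
  obtain ⟨S, -, hS⟩ := exists_matrix_of_linearMap f.symm.toLinearMap
  exact Matrix.square_of_invertible S T
    (matrix_mul_eq_one ha (fun x ↦ f.symm_apply_apply x) hT hS)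
    (matrix_mul_eq_one hb (fun x ↦ f.apply_symm_apply x) hS hT)

end Matrix

section Dedekind

variable [IsDedekindDomain R]

lemma exists_add_spanSingleton_eq {I J : FractionalIdeal R⁰ K} (hIJ : I ≤ J) (hI : I ≠ 0) :
    ∃ x : K, I + spanSingleton R⁰ x = J := by
  obtain ⟨d, J₀, hd, rfl⟩ := exists_eq_spanSingleton_mul J
  have hd' : algebraMap R K d ≠ 0 := by simpa using hd
  have hd₁ : spanSingleton R⁰ (algebraMap R K d) * spanSingleton R⁰ (algebraMap R K d)⁻¹ = 1 := by
    rw [spanSingleton_mul_spanSingleton, mul_inv_cancel₀ hd', spanSingleton_one]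
  have hle : spanSingleton R⁰ (algebraMap R K d) * I ≤ J₀ := by
    have := mul_le_mul_right hIJ (spanSingleton R⁰ (algebraMap R K d))
    rwa [← mul_assoc, hd₁, one_mul] at this
  obtain ⟨I₀, hI₀⟩ := le_one_iff_exists_coeIdeal.mp (hle.trans coeIdeal_le_one)
  have hI₀J₀ : I₀ ≤ J₀ := by
    rwa [← hI₀, coeIdeal_le_coeIdeal] at hle
  have hI₁ : I = spanSingleton R⁰ (algebraMap R K d)⁻¹ * I₀ := by
    rw [hI₀, ← mul_assoc, mul_comm (spanSingleton _ _⁻¹), hd₁, one_mul]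
  have hI₀_ne : I₀ ≠ 0 := by
    rintro rfl
    exact hI (by simp [hI₁])
  obtain ⟨x, hx⟩ := IsDedekindDomain.exists_sup_span_eq hI₀J₀ hI₀_ne
  refine ⟨(algebraMap R K d)⁻¹ * algebraMap R K x, ?_⟩
  rw [hI₁, ← hx, coeIdeal_sup, coeIdeal_span_singleton, mul_add, spanSingleton_mul_spanSingleton]

lemma exists_mul_add_mul_eq_one {a b : FractionalIdeal R⁰ K} (ha : a ≠ 0) (hb : b ≠ 0) :
    ∃ α ∈ a⁻¹, ∃ β ∈ b⁻¹, ∃ x ∈ a, ∃ y ∈ b, α * x + β * y = 1 := by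
  obtain ⟨β, hβ, hβ₀⟩ : ∃ β ∈ b⁻¹, β ≠ 0 := by
    by_contra! h
    exact inv_ne_zero hb (eq_zero_iff.mpr h)
  have hle : spanSingleton R⁰ β * b ≤ 1 := by
    rw [← inv_mul_cancel₀ hb]
    exact mul_le_mul_left (spanSingleton_le_iff_mem.mpr hβ) b
  obtain ⟨α, hα⟩ := exists_add_spanSingleton_eq
    (I := spanSingleton R⁰ β * b * a⁻¹) (J := a⁻¹)
    (by simpa using mul_le_mul_left hle a⁻¹)
    (mul_ne_zero (mul_ne_zero (spanSingleton_ne_zero_iff.mpr hβ₀) hb) (inv_ne_zero ha))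
  have hα_mem : α ∈ a⁻¹ := by
    rw [← spanSingleton_le_iff_mem, ← hα]
    exact le_add_of_nonneg_left (zero_le _)
  have h_one : (1 : K) ∈ spanSingleton R⁰ α * a + spanSingleton R⁰ β * b := by
    have := congrArg (· * a) hα
    simp only [add_mul, mul_assoc, inv_mul_cancel₀ ha, mul_one] at this
    rw [add_comm, this]
    exact one_mem_one R⁰
  obtain ⟨u, hu, v, hv, huv⟩ := (mem_add _ _ _).mp h_one
  obtain ⟨x, hx, rfl⟩ := mem_singleton_mul.mp hu
  obtain ⟨y, hy, rfl⟩ := mem_singleton_mul.mp hv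
  exact ⟨α, hα_mem, β, hβ, x, hx, y, hy, huv⟩

lemma mul_mem_of_mem_inv {a b : FractionalIdeal R⁰ K} (ha : a ≠ 0) {α s : K} (hα : α ∈ a⁻¹)
    (hs : s ∈ a * b) : α * s ∈ b := by
  have := mul_mem_mul hα hs
  rwa [← mul_assoc, inv_mul_cancel₀ ha, one_mul] at this

/-- Steinitz's isomorphism `a ⊕ b ≃ R ⊕ ab`. -/
theorem nonempty_prod_linearEquiv {a b : FractionalIdeal R⁰ K} (ha : a ≠ 0) (hb : b ≠ 0) :
    Nonempty ((↥(a : Submodule R K) × ↥(b : Submodule R K)) ≃ₗ[R]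
      ((1 : FractionalIdeal R⁰ K) : Submodule R K) ×
        ((a * b : FractionalIdeal R⁰ K) : Submodule R K)) := by
  obtain ⟨α, hα, β, hβ, x, hx, y, hy, h⟩ := exists_mul_add_mul_eq_one ha hb
  have mem_one {c : FractionalIdeal R⁰ K} (hc : c ≠ 0) {γ z : K} (hγ : γ ∈ c⁻¹) (hz : z ∈ c) :
      γ * z ∈ (1 : FractionalIdeal R⁰ K) := mul_mem_of_mem_inv hc hγ (by rwa [mul_one])
  refine ⟨{ toFun := fun p ↦
              (⟨α * p.1 + β * p.2, Submodule.add_mem _ (mem_one ha hα p.1.2) (mem_one hb hβ p.2.2)⟩,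
                ⟨x * p.2 - p.1 * y,
                  Submodule.sub_mem _ (mul_mem_mul hx p.2.2) (mul_mem_mul p.1.2 hy)⟩)
            invFun := fun q ↦
              (⟨q.1 * x - β * q.2, Submodule.sub_mem _
                  (by simpa using mul_mem_mul q.1.2 hx)
                  (mul_mem_of_mem_inv hb hβ (by rw [mul_comm]; exact q.2.2))⟩,
                ⟨q.1 * y + α * q.2, Submodule.add_mem _
                  (by simpa using mul_mem_mul q.1.2 hy)
                  (mul_mem_of_mem_inv ha hα q.2.2)⟩)
            map_add' := fun p q ↦ ?_
            map_smul' := fun r p ↦ ?_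
            left_inv := fun p ↦ ?_
            right_inv := fun q ↦ ?_ }⟩ <;>
    refine Prod.ext (Subtype.ext ?_) (Subtype.ext ?_)
  · simp; ring
  · simp; ring
  · simp [Algebra.smul_def]; ring
  · simp [Algebra.smul_def]; ring
  · dsimp; linear_combination (p.1 : K) * h
  · dsimp; linear_combination (p.2 : K) * h
  · dsimp; linear_combination (q.1 : K) * h
  · dsimp; linear_combination (q.2 : K) * h

/-- The Steinitz normal form `a₀ ⊕ ⋯ ⊕ aₙ ≃ a₀⋯aₙ ⊕ Rⁿ`. -/
theorem nonempty_pi_linearEquiv {n : ℕ} (a : Fin (n + 1) → FractionalIdeal R⁰ K)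
    (ha : ∀ i, a i ≠ 0) :
    Nonempty (PiModule a ≃ₗ[R] ((∏ i, a i : FractionalIdeal R⁰ K) : Submodule R K) ×
      (Fin n → ((1 : FractionalIdeal R⁰ K) : Submodule R K))) := by
  induction n with
  | zero =>
    have h : ∏ i, a i = a 0 := by simp
    rw [h]
    exact ⟨(Fin.consLinearEquiv R fun i ↦ (a i : Submodule R K)).symm ≪≫ₗ
      LinearEquiv.prodCongr (.refl R _) (.ofSubsingleton _ _)⟩
  | succ n ih =>
    obtain ⟨e⟩ := ih (fun i ↦ a i.succ) fun i ↦ ha i.succ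
    obtain ⟨f⟩ := nonempty_prod_linearEquiv (ha 0)
      (Finset.prod_ne_zero_iff.mpr fun (i : Fin (n + 1)) _ ↦ ha i.succ)
    rw [Fin.prod_univ_succ]
    exact ⟨(Fin.consLinearEquiv R fun i ↦ (a i : Submodule R K)).symm ≪≫ₗ
      LinearEquiv.prodCongr (.refl R _) e ≪≫ₗ (LinearEquiv.prodAssoc R _ _ _).symm ≪≫ₗ
      LinearEquiv.prodCongr (f ≪≫ₗ LinearEquiv.prodComm R _ _) (.refl R _) ≪≫ₗ
      LinearEquiv.prodAssoc R _ _ _ ≪≫ₗ LinearEquiv.prodCongr (.refl R _)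
        (Fin.consLinearEquiv R fun _ ↦ ((1 : FractionalIdeal R⁰ K) : Submodule R K))⟩

end Dedekind

end FractionalIdeal

/-- Two lattices `a₁ ⊕ ⋯ ⊕ aₘ` and `b₁ ⊕ ⋯ ⊕ bₙ` over a Dedekind domain
`R` (all `aᵢ`, `bⱼ` nonzero fractional ideals) are isomorphic as `R`-modules iff `m = n`
and the products `a₁⋯aₘ` and `b₁⋯bₙ` lie in the same ideal class. -/
theorem stmt1 (R : Type*) [CommRing R] [IsDedekindDomain R]
    (K : Type*) [Field K] [Algebra R K] [IsFractionRing R K]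
    (m n : ℕ) (a : Fin m → FractionalIdeal R⁰ K) (b : Fin n → FractionalIdeal R⁰ K)
    (ha : ∀ i, a i ≠ 0) (hb : ∀ j, b j ≠ 0) :
    Nonempty ((((i : Fin m) → ((a i : Submodule R K) : Type _))) ≃ₗ[R]
        ((j : Fin n) → ((b j : Submodule R K) : Type _)))
      ↔ (m = n ∧ ∃ c : K, c ≠ 0 ∧
          FractionalIdeal.spanSingleton R⁰ c * ∏ i, a i = ∏ j, b j) := by
  constructor
  · rintro ⟨f⟩
    obtain rfl : m = n := by simpa using FractionalIdeal.card_eq_of_linearEquiv ha hb f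
    exact ⟨rfl, FractionalIdeal.exists_spanSingleton_mul_prod_eq_of_linearEquiv ha f⟩
  · rintro ⟨rfl, c, hc, h⟩
    cases m with
    | zero => exact ⟨.ofSubsingleton _ _⟩
    | succ k =>
      obtain ⟨e⟩ := FractionalIdeal.nonempty_pi_linearEquiv a ha
      obtain ⟨f⟩ := FractionalIdeal.nonempty_pi_linearEquiv b hb
      obtain ⟨g⟩ := FractionalIdeal.nonempty_linearEquiv_of_spanSingleton_mul_eq hc h
      exact ⟨e ≪≫ₗ LinearEquiv.prodCongr g (.refl R _) ≪≫ₗ f.symm⟩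
end

section
/- Quadratic algebras over a Dedekind domain R are in canonical bijection with pairs (M, φ) where M is a rank-2 R-lattice, φ : M → R is a quadratic form, and φ attains the value 1 on some element of M. -/
universe u

open scoped TensorProduct

/-- A quadratic algebra over `R`: a rank-2 lattice with a commutative unital
`R`-algebra structure. -/
structure QuadAlg (R : Type u) [CommRing R] : Type (u + 1) where
  carrier : Type u
  [commRing : CommRing carrier]
  [algebra : Algebra R carrier]
  [finite : Module.Finite R carrier]
  [torsionFree : NoZeroSMulDivisors R carrier]
  rank_eq : Module.finrank R carrier = 2

attribute [instance] QuadAlg.commRing QuadAlg.algebra QuadAlg.finite QuadAlg.torsionFree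

section TwoDim

open Module

variable {K A B : Type*} [Field K] [CommRing A] [Algebra K A] [CommRing B] [Algebra K B]

theorem norm_algebraMap_add_of_finrank_eq_two (hA : finrank K A = 2) (c : K) (x : A) :
    Algebra.norm K (algebraMap K A c + x) =
      c ^ 2 + c * Algebra.trace K A x + Algebra.norm K x := by
  have : FiniteDimensional K A := .of_finrank_pos (by lia)
  let b := finBasisOfFinrankEq K A hA
  rw [Algebra.norm_eq_matrix_det b, Algebra.norm_eq_matrix_det b, Algebra.trace_eq_matrix_trace b,
    map_add, AlgHom.commutes, Matrix.det_fin_two, Matrix.det_fin_two, Matrix.trace_fin_two]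
  simp [Matrix.algebraMap_matrix_apply]
  ring

theorem mul_self_eq_of_finrank_eq_two (hA : finrank K A = 2) (x : A) :
    x * x = Algebra.trace K A x • x - algebraMap K A (Algebra.norm K x) := by
  have : FiniteDimensional K A := .of_finrank_pos (by lia)
  let b := finBasisOfFinrankEq K A hA
  apply Algebra.leftMulMatrix_injective b
  rw [Algebra.norm_eq_matrix_det b, Algebra.trace_eq_matrix_trace b, map_sub, map_smul, map_mul,
    AlgHom.commutes]
  ext i j
  fin_cases i <;> fin_cases j <;>
    simp [Matrix.algebraMap_matrix_apply, Matrix.mul_apply, Fin.sum_univ_two,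
      Matrix.det_fin_two, Matrix.trace_fin_two] <;> ring

theorem exists_forall_eq_of_finrank_eq_two (hA : finrank K A = 2) :
    ∃ w : A, ∀ x : A, ∃ a b : K, x = algebraMap K A a + b • w := by
  have : FiniteDimensional K A := .of_finrank_pos (by lia)
  have : Nontrivial A := nontrivial_of_finrank_pos (R := K) (by lia)
  have hq : finrank K (A ⧸ K ∙ (1 : A)) = 1 := by
    have := Submodule.finrank_quotient_add_finrank (K ∙ (1 : A))
    rw [finrank_span_singleton one_ne_zero] at this
    lia
  obtain ⟨v, -, hv⟩ := finrank_eq_one_iff'.1 hq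
  obtain ⟨w, rfl⟩ := Submodule.mkQ_surjective _ v
  refine ⟨w, fun x => ?_⟩
  obtain ⟨b, hb⟩ := hv (Submodule.mkQ _ x)
  rw [← map_smul, eq_comm, Submodule.mkQ_apply, Submodule.mkQ_apply, Submodule.Quotient.eq,
    Submodule.mem_span_singleton] at hb
  obtain ⟨a, ha⟩ := hb
  exact ⟨a, b, by rw [Algebra.algebraMap_eq_smul_one, ha, sub_add_cancel]⟩

theorem trace_map_of_norm_map (hA : finrank K A = 2) (hB : finrank K B = 2) (F : A →ₗ[K] B)
    (h1 : F 1 = 1) (hF : ∀ x, Algebra.norm K (F x) = Algebra.norm K x) (x : A) :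
    Algebra.trace K B (F x) = Algebra.trace K A x := by
  have h := hF (algebraMap K A 1 + x)
  rw [map_add, map_one, h1, ← map_one (algebraMap K B), ← map_one (algebraMap K A),
    norm_algebraMap_add_of_finrank_eq_two hA, norm_algebraMap_add_of_finrank_eq_two hB, hF] at h
  linear_combination h

theorem map_mul_of_norm_map (hA : finrank K A = 2) (hB : finrank K B = 2) (F : A →ₗ[K] B)
    (h1 : F 1 = 1) (hF : ∀ x, Algebra.norm K (F x) = Algebra.norm K x) (x y : A) :
    F (x * y) = F x * F y := by
  obtain ⟨w, hw⟩ := exists_forall_eq_of_finrank_eq_two hA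
  have hFw : F (w * w) = F w * F w := by
    rw [mul_self_eq_of_finrank_eq_two hA, mul_self_eq_of_finrank_eq_two hB,
      trace_map_of_norm_map hA hB F h1 hF, hF, Algebra.algebraMap_eq_smul_one,
      Algebra.algebraMap_eq_smul_one, map_sub, map_smul, map_smul, h1]
  obtain ⟨a, b, rfl⟩ := hw x
  obtain ⟨c, d, rfl⟩ := hw y
  simp only [Algebra.algebraMap_eq_smul_one, add_mul, mul_add, smul_mul_smul_comm, one_mul,
    mul_one, map_add, map_smul, h1, hFw]

theorem trace_one_of_finrank_eq_two (hA : finrank K A = 2) : Algebra.trace K A 1 = 2 := by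
  rw [← map_one (algebraMap K A), Algebra.trace_algebraMap, hA]
  simp

theorem norm_algebraMap_trace_sub (hA : finrank K A = 2) (x : A) :
    Algebra.norm K (algebraMap K A (Algebra.trace K A x) - x) = Algebra.norm K x := by
  have hn : algebraMap K A (Algebra.trace K A x) - x =
      algebraMap K A (-1) * (algebraMap K A (-Algebra.trace K A x) + x) := by
    rw [map_neg, map_neg, map_one]
    ring
  rw [hn, map_mul, norm_algebraMap_add_of_finrank_eq_two hA, Algebra.norm_algebraMap, hA]
  ring

/-- The standard involution of a two-dimensional algebra. -/
noncomputable def standardInvolution (hA : finrank K A = 2) : A →ₐ[K] A :=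
  let F : A →ₗ[K] A := (Algebra.linearMap K A) ∘ₗ Algebra.trace K A - LinearMap.id
  have h1 : F 1 = 1 := by
    simp only [F, LinearMap.sub_apply, LinearMap.comp_apply, trace_one_of_finrank_eq_two hA,
      LinearMap.id_apply, Algebra.linearMap_apply, map_ofNat]
    norm_num
  AlgHom.ofLinearMap F h1 (map_mul_of_norm_map hA hA F h1 (norm_algebraMap_trace_sub hA))

theorem standardInvolution_apply (hA : finrank K A = 2) (x : A) :
    standardInvolution hA x = algebraMap K A (Algebra.trace K A x) - x := rfl

theorem mul_standardInvolution (hA : finrank K A = 2) (x : A) :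
    x * standardInvolution hA x = algebraMap K A (Algebra.norm K x) := by
  rw [standardInvolution_apply, mul_sub, mul_self_eq_of_finrank_eq_two hA, Algebra.smul_def]
  ring

theorem exists_algebraMap_eq_trace {R : Type*} [CommRing R] [Algebra R K]
    [IsFractionRing R K] [IsIntegrallyClosed R] [Algebra R A] [IsScalarTower R K A]
    (hA : finrank K A = 2) {x : A} (hx : IsIntegral R x) :
    ∃ t : R, algebraMap R K t = Algebra.trace K A x := by
  have : Nontrivial A := nontrivial_of_finrank_pos (R := K) (by lia)
  rw [← IsIntegrallyClosed.isIntegral_iff,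
    ← isIntegral_algebraMap_iff (algebraMap K A).injective]
  have := hx.add (hx.map ((standardInvolution hA).restrictScalars R))
  simpa [standardInvolution_apply] using this

end TwoDim

section Lattice

open Module
open scoped nonZeroDivisors

variable {R : Type*} [CommRing R] [IsDedekindDomain R]
variable (K : Type*) [Field K] [Algebra R K] [IsFractionRing R K]

theorem mk_one_injective_of_isTorsionFree (M : Type*) [AddCommGroup M] [Module R M]
    [IsTorsionFree R M] : Function.Injective (TensorProduct.mk R K M 1) :=
  Flat.tensorProduct_mk_injective R M K

theorem exists_smul_eq_one_tmul {M : Type*} [AddCommGroup M] [Module R M] (y : K ⊗[R] M) :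
    ∃ (r : R) (x : M), r ≠ 0 ∧ algebraMap R K r • y = 1 ⊗ₜ[R] x := by
  obtain ⟨⟨x, s⟩, h⟩ := IsLocalizedModule.surj R⁰ (TensorProduct.mk R K M 1) y
  exact ⟨s, x, nonZeroDivisors.coe_ne_zero s, by rw [algebraMap_smul]; exact h⟩

theorem norm_baseChange_of_norm {S T : Type*} [CommRing S] [Algebra R S] [CommRing T] [Algebra R T]
    (hS : finrank K (K ⊗[R] S) = 2) (hT : finrank K (K ⊗[R] T) = 2) (e : S →ₗ[R] T)
    (he : ∀ x, Algebra.norm K (1 ⊗ₜ[R] e x : K ⊗[R] T) = Algebra.norm K (1 ⊗ₜ[R] x : K ⊗[R] S))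
    (y : K ⊗[R] S) : Algebra.norm K (e.baseChange K y) = Algebra.norm K y := by
  obtain ⟨r, x, hr, hx⟩ := exists_smul_eq_one_tmul K y
  have h := he x
  rw [← LinearMap.baseChange_tmul, ← hx, map_smul, Algebra.smul_def, Algebra.smul_def, map_mul,
    map_mul, Algebra.norm_algebraMap, Algebra.norm_algebraMap, hS, hT] at h
  exact mul_left_cancel₀
    (pow_ne_zero 2 (by simpa using hr : algebraMap R K r ≠ 0)) h

theorem nonempty_algEquiv_of_norm {S T : Type*} [CommRing S] [Algebra R S] [Module.Finite R S]
    [IsTorsionFree R S] [CommRing T] [Algebra R T] [Module.Finite R T] [IsTorsionFree R T]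
    (hS : finrank R S = 2) (hT : finrank R T = 2) (e : S ≃ₗ[R] T)
    (he : ∀ x, Algebra.norm K (1 ⊗ₜ[R] e x : K ⊗[R] T) =
      Algebra.norm K (1 ⊗ₜ[R] x : K ⊗[R] S)) : Nonempty (S ≃ₐ[R] T) := by
  have hKS : finrank K (K ⊗[R] S) = 2 := by
    rw [(TensorProduct.isBaseChange R S K).finrank_eq, hS]
  have hKT : finrank K (K ⊗[R] T) = 2 := by
    rw [(TensorProduct.isBaseChange R T K).finrank_eq, hT]
  set u : K ⊗[R] T := 1 ⊗ₜ[R] e 1 with hu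
  have hui : IsIntegral R u :=
    (Algebra.IsIntegral.isIntegral (R := R) (e 1)).map
      (Algebra.TensorProduct.includeRight : T →ₐ[R] K ⊗[R] T)
  obtain ⟨t, ht⟩ := exists_algebraMap_eq_trace hKT hui
  have hNu : Algebra.norm K u = 1 := by
    rw [hu, he, ← Algebra.TensorProduct.one_def, map_one]
  set w : T := algebraMap R T t - e 1 with hw
  have hwu : 1 ⊗ₜ[R] w = standardInvolution hKT u := by
    rw [standardInvolution_apply, ← ht, hw, TensorProduct.tmul_sub, ← hu,
      Algebra.algebraMap_eq_smul_one, TensorProduct.tmul_smul, ← Algebra.TensorProduct.one_def,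
      ← IsScalarTower.algebraMap_apply,
      Algebra.algebraMap_eq_smul_one]
  have inj := mk_one_injective_of_isTorsionFree (R := R) K T
  have hwe : w * e 1 = 1 := by
    apply inj
    have := mul_standardInvolution hKT u
    rw [hNu, map_one, ← hwu, hu, Algebra.TensorProduct.tmul_mul_tmul, one_mul, mul_comm] at this
    simpa [Algebra.TensorProduct.one_def] using this
  let F : K ⊗[R] S →ₗ[K] K ⊗[R] T :=
    LinearMap.mulLeft K (1 ⊗ₜ[R] w) ∘ₗ e.toLinearMap.baseChange K
  have hF (x : S) : F (1 ⊗ₜ[R] x) = 1 ⊗ₜ[R] (w * e x) := by simp [F]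
  have hF1 : F 1 = 1 := by
    rw [Algebra.TensorProduct.one_def, hF, hwe, Algebra.TensorProduct.one_def]
  have hNF (y) : Algebra.norm K (F y) = Algebra.norm K y := by
    simp only [F, LinearMap.comp_apply, LinearMap.mulLeft_apply, map_mul]
    rw [hwu, standardInvolution_apply, norm_algebraMap_trace_sub hKT, hNu, one_mul,
      norm_baseChange_of_norm K hKS hKT e.toLinearMap he]
  let f : S →ₐ[R] T := AlgHom.ofLinearMap (LinearMap.mulLeft R w ∘ₗ e.toLinearMap) hwe fun x y => by
    apply inj
    have := map_mul_of_norm_map hKS hKT F hF1 hNF (1 ⊗ₜ[R] x) (1 ⊗ₜ[R] y)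
    rw [Algebra.TensorProduct.tmul_mul_tmul, one_mul, hF, hF, hF,
      Algebra.TensorProduct.tmul_mul_tmul, one_mul] at this
    simpa using this
  have hw_unit : IsUnit w := .of_mul_eq_one _ hwe
  exact ⟨AlgEquiv.ofBijective f (IsUnit.isUnit_iff_mulLeft_bijective.1 hw_unit |>.comp e.bijective)⟩

theorem exists_injective_apply_eq_one_of_finrank_eq_one (L : Type*) [AddCommGroup L] [Module R L]
    [IsTorsionFree R L] (hL : finrank R L = 1) :
    ∃ (w : L) (q : L →ₗ[R] K), Function.Injective q ∧ q w = 1 := by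
  have : Nontrivial L := nontrivial_of_finrank_pos (R := R) (by lia)
  obtain ⟨w, hw⟩ := exists_ne (0 : L)
  have inj := mk_one_injective_of_isTorsionFree (R := R) K L
  have hKL : finrank K (K ⊗[R] L) = 1 := by
    rw [(TensorProduct.isBaseChange R L K).finrank_eq, hL]
  let b := FiniteDimensional.basisSingleton Unit hKL (1 ⊗ₜ[R] w) fun h =>
    hw (inj (by simpa using h))
  let c : K ⊗[R] L ≃ₗ[K] K := b.equivFun ≪≫ₗ LinearEquiv.funUnique Unit K K
  refine ⟨w, c.toLinearMap.restrictScalars R ∘ₗ TensorProduct.mk R K L 1,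
    c.injective.comp inj, ?_⟩
  have : b () = 1 ⊗ₜ[R] w := by simp [b]
  simp [c, ← this]

theorem mul_mem_range_of_norm {M : Type*} [AddCommGroup M] [Module R M] {t n : R}
    {f : M →ₗ[R] QuadraticAlgebra K (-algebraMap R K n) (algebraMap R K t)} {p : M →ₗ[R] R}
    {φ : M → R} {m : M} (hm : f m = 1) (hp : ∀ x, (f x).re = algebraMap R K (p x))
    (hφ : ∀ x, algebraMap R K (φ x) = QuadraticAlgebra.norm (f x))
    (ht : ∀ x, ∃ s : R, algebraMap R K s = algebraMap R K t * (f x).im) (x y : M) :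
    f x * f y ∈ LinearMap.range f := by
  have hsm (r : R) (x : K) : r • x = algebraMap R K r * x := Algebra.smul_def r x
  have hφ' (z : M) : ∃ d : R, algebraMap R K d = algebraMap R K n * (f z).im ^ 2 := by
    refine ⟨φ (z - p z • m), ?_⟩
    rw [hφ, map_sub, map_smul, hm, QuadraticAlgebra.norm_def]
    simp [hp, hsm, QuadraticAlgebra.re_one, QuadraticAlgebra.im_one]
    ring
  obtain ⟨s, hs⟩ := ht x
  obtain ⟨c, hc⟩ := hφ' x
  obtain ⟨d, hd⟩ := hφ' y
  obtain ⟨k, hk⟩ : ∃ k : R, algebraMap R K k = algebraMap R K n * (f x).im * (f y).im := by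
    rw [← IsIntegrallyClosed.isIntegral_iff]
    refine .of_pow zero_lt_two ?_
    have : (algebraMap R K n * (f x).im * (f y).im) ^ 2 = algebraMap R K (c * d) := by
      rw [map_mul, hc, hd]
      ring
    rw [this]
    exact isIntegral_algebraMap
  refine ⟨(p x) • y + p y • x - (p x * p y) • m - k • m + s • (y - p y • m), ?_⟩
  simp only [map_add, map_sub, map_smul, hm]
  ext <;>
    simp [hp, hsm, hk, hs, QuadraticAlgebra.re_one, QuadraticAlgebra.im_one] <;> ring

theorem norm_includeRight_subalgebra {A : Type*} [CommRing A] [Algebra K A] [Algebra R A]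
    [IsScalarTower R K A] (S : Subalgebra R A)
    (hA : 0 < finrank K A) (hS : finrank R S = finrank K A)
    (hspan : Submodule.span K (S : Set A) = ⊤) (x : S) :
    Algebra.norm K (Algebra.TensorProduct.includeRight x : K ⊗[R] S) = Algebra.norm K (x : A) := by
  have : FiniteDimensional K A := .of_finrank_pos hA
  have hKS : finrank K (K ⊗[R] S) = finrank K A := by
    rw [(TensorProduct.isBaseChange R S K).finrank_eq, hS]
  let F : K ⊗[R] S →ₐ[K] A := Algebra.TensorProduct.lift (Algebra.ofId K A) S.val
    fun _ _ => .all _ _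
  have hF (y : S) : F (1 ⊗ₜ[R] y) = y := by simp [F]
  have hsurj : Function.Surjective F.toLinearMap := by
    rw [← LinearMap.range_eq_top, eq_top_iff, ← hspan, Submodule.span_le]
    exact fun y hy => ⟨1 ⊗ₜ[R] ⟨y, hy⟩, hF ⟨y, hy⟩⟩
  have : FiniteDimensional K (K ⊗[R] S) := .of_finrank_pos (by lia)
  have hinj := (LinearMap.injective_iff_surjective_of_finrank_eq_finrank hKS).2 hsurj
  rw [← hF x]
  exact (Algebra.norm_eq_of_algEquiv (AlgEquiv.ofBijective F ⟨hinj, hsurj⟩) _).symm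

section QuadraticForm

variable {M : Type*} [AddCommGroup M] [Module R M] [Module.Finite R M] [IsTorsionFree R M]

/-- A vector on which a quadratic form takes the value `1` is unimodular. -/
theorem exists_dual_apply_eq_one_of_map_eq_one (φ : QuadraticMap R M R) {m : M} (hm : φ m = 1) :
    ∃ p : M →ₗ[R] R, p m = 1 := by
  have hm0 : m ≠ 0 := by
    rintro rfl
    simp at hm
  have : IsTorsionFree R (M ⧸ R ∙ m) := .of_smul_eq_zero fun r x hrx => by
    obtain ⟨x, rfl⟩ := Submodule.mkQ_surjective _ x
    rw [or_iff_not_imp_left]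
    intro hr
    rw [← map_smul, Submodule.mkQ_apply, Submodule.Quotient.mk_eq_zero,
      Submodule.mem_span_singleton] at hrx
    obtain ⟨a, ha⟩ := hrx
    have h := congrArg φ ha
    rw [φ.map_smul, φ.map_smul, hm, smul_eq_mul, smul_eq_mul, mul_one, ← sq, ← sq] at h
    obtain ⟨c, rfl⟩ := (IsIntegrallyClosed.pow_dvd_pow_iff two_ne_zero).1 (Dvd.intro _ h.symm)
    rw [mul_smul] at ha
    rw [Submodule.mkQ_apply, Submodule.Quotient.mk_eq_zero, ← smul_right_injective M hr ha]
    exact Submodule.smul_mem _ _ (Submodule.mem_span_singleton_self m)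
  have : FinitePresentation R (M ⧸ R ∙ m) := finitePresentation_of_finite R _
  have : Projective R (M ⧸ R ∙ m) := Flat.projective_of_finitePresentation
  obtain ⟨s, hs⟩ := projective_lifting_property (R ∙ m).mkQ LinearMap.id
    (Submodule.mkQ_surjective _)
  let g : M →ₗ[R] R ∙ m := (LinearMap.id - s ∘ₗ (R ∙ m).mkQ).codRestrict _ fun x => by
    have h := LinearMap.congr_fun hs ((R ∙ m).mkQ x)
    rw [LinearMap.comp_apply, LinearMap.id_apply] at h
    rw [← Submodule.Quotient.mk_eq_zero, ← Submodule.mkQ_apply, LinearMap.sub_apply, map_sub,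
      LinearMap.comp_apply, h, LinearMap.id_apply, sub_self]
  refine ⟨(LinearEquiv.toSpanNonzeroSingleton R M m hm0).symm.toLinearMap ∘ₗ g, ?_⟩
  have hg : g m = ⟨m, Submodule.mem_span_singleton_self m⟩ := by
    ext
    have : (R ∙ m).mkQ m = 0 := by simp
    simp [g, -Submodule.mkQ_apply, this]
  rw [LinearMap.comp_apply, hg, LinearEquiv.coe_coe, LinearEquiv.symm_apply_eq]
  ext
  simp

/-- Over the fraction field, a binary quadratic form representing `1` is the norm form of a
quadratic algebra. -/
theorem exists_linearMap_quadraticAlgebra (hM : finrank R M = 2) (φ : QuadraticMap R M R) {m : M}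
    (hm : φ m = 1) :
    ∃ (t n : R) (f : M →ₗ[R] QuadraticAlgebra K (-algebraMap R K n) (algebraMap R K t))
      (p : M →ₗ[R] R), Function.Injective f ∧ f m = 1 ∧ (∃ w, (f w).im ≠ 0) ∧
      (∀ x, (f x).re = algebraMap R K (p x)) ∧
      (∀ x, algebraMap R K (φ x) = QuadraticAlgebra.norm (f x)) ∧
      ∀ x, ∃ s : R, algebraMap R K s = algebraMap R K t * (f x).im := by
  obtain ⟨p, hp⟩ := exists_dual_apply_eq_one_of_map_eq_one φ hm
  have hL : finrank R (LinearMap.ker p) = 1 := by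
    have h := Submodule.finrank_quotient_add_finrank (LinearMap.ker p)
    have hsurj : Function.Surjective p := fun r => ⟨r • m, by simp [hp]⟩
    rw [(p.quotKerEquivOfSurjective hsurj).finrank_eq, finrank_self] at h
    lia
  obtain ⟨⟨w, hwp⟩, q, hq, hqw⟩ :=
    exists_injective_apply_eq_one_of_finrank_eq_one K (LinearMap.ker p) hL
  let π : M →ₗ[R] LinearMap.ker p :=
    (LinearMap.id - p.smulRight m).codRestrict _ fun x => by simp [hp]
  have hπ_apply (x : M) : (π x : M) = x - p x • m := rfl
  have hπ (x : M) : x = p x • m + π x := by simp [hπ_apply]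
  have hqx (x : M) : ∃ r b : R, r ≠ 0 ∧ algebraMap R K r * q (π x) = algebraMap R K b ∧
      r • (π x : M) = b • w := by
    obtain ⟨b, r, hr, hbr⟩ := IsFractionRing.div_surjective (A := R) (q (π x))
    have hr0 : r ≠ 0 := nonZeroDivisors.ne_zero hr
    have hrK : algebraMap R K r ≠ 0 := by simpa using hr0
    have h : algebraMap R K r * q (π x) = algebraMap R K b := by
      rw [← hbr]
      field_simp
    refine ⟨r, b, hr0, h, ?_⟩
    have : r • π x = b • ⟨w, hwp⟩ := hq (by
      rw [map_smul, map_smul, hqw, Algebra.smul_def, Algebra.smul_def, h, mul_one])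
    simpa using congrArg Subtype.val this
  have hpolar : ∀ a b : R, φ (a • m + b • w) =
      a ^ 2 + a * b * QuadraticMap.polar φ m w + b ^ 2 * φ w := fun a b => by
    rw [QuadraticMap.map_add φ, φ.map_smul, φ.map_smul, φ.polar_smul_left, φ.polar_smul_right, hm]
    simp only [smul_eq_mul]
    ring
  have hsm (r : R) (x : K) : r • x = algebraMap R K r * x := Algebra.smul_def r x
  let f : M →ₗ[R] QuadraticAlgebra K (-algebraMap R K (φ w))
      (algebraMap R K (QuadraticMap.polar φ m w)) :=
    { toFun x := ⟨algebraMap R K (p x), q (π x)⟩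
      map_add' x y := by ext <;> simp
      map_smul' r x := by ext <;> simp [hsm] }
  have hπm : π m = 0 := by
    ext
    simp [hπ_apply, hp]
  have hπw : π w = ⟨w, hwp⟩ := by
    ext
    simp [hπ_apply, LinearMap.mem_ker.1 hwp]
  refine ⟨QuadraticMap.polar φ m w, φ w, f, p, ?_, ?_, ⟨w, ?_⟩, fun x => rfl, fun x => ?_,
    fun x => ?_⟩
  · intro x y hxy
    have h1 : p x = p y :=
      IsFractionRing.injective R K (congrArg QuadraticAlgebra.re hxy)
    have h2 : π x = π y := hq (congrArg QuadraticAlgebra.im hxy)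
    rw [hπ x, hπ y, h1, h2]
  · ext <;> simp [f, hp, hπm, QuadraticAlgebra.re_one, QuadraticAlgebra.im_one]
  · simp [f, hπw, hqw]
  · obtain ⟨r, b, hr, hrq, hrb⟩ := hqx x
    have hrK : algebraMap R K r ≠ 0 := by simpa using hr
    have hrx : r • x = (r * p x) • m + b • w := by
      rw [← hrb, mul_smul, ← smul_add, ← hπ]
    have h := congrArg (algebraMap R K ∘ φ) hrx
    simp only [Function.comp_apply, φ.map_smul, hpolar, smul_eq_mul, map_mul, map_add, map_pow,
      ← hrq] at h
    refine mul_left_cancel₀ (mul_ne_zero hrK hrK) (h.trans ?_)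
    simp only [QuadraticAlgebra.norm_def, f, LinearMap.coe_mk, AddHom.coe_mk]
    ring
  · obtain ⟨r, b, hr, hrq, hrb⟩ := hqx x
    have hrK : algebraMap R K r ≠ 0 := by simpa using hr
    refine ⟨QuadraticMap.polar φ m (π x), mul_left_cancel₀ hrK ?_⟩
    have h := congrArg (QuadraticMap.polar φ m) hrb
    rw [φ.polar_smul_right, φ.polar_smul_right, smul_eq_mul, smul_eq_mul] at h
    simp only [f, LinearMap.coe_mk, AddHom.coe_mk]
    rw [← map_mul, h, map_mul, ← hrq]
    ring

end QuadraticForm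

theorem exists_quadAlg_of_map_eq_one {R : Type u} [CommRing R] [IsDedekindDomain R]
    (K : Type u) [Field K] [Algebra R K] [IsFractionRing R K] {M : Type*} [AddCommGroup M]
    [Module R M] [Module.Finite R M] [NoZeroSMulDivisors R M]
    (hM : finrank R M = 2)
    (φ : QuadraticMap R M R) {m : M} (hm : φ m = 1) :
    ∃ (S : QuadAlg R) (e : S.carrier ≃ₗ[R] M), ∀ x : S.carrier,
      algebraMap R K (φ (e x)) =
        Algebra.norm K (Algebra.TensorProduct.includeRight x : K ⊗[R] S.carrier) := by
  obtain ⟨t, n, f, p, hf, hfm, ⟨w, hw⟩, hp, hφ, ht⟩ :=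
    exists_linearMap_quadraticAlgebra K hM φ hm
  have hA : finrank K (QuadraticAlgebra K (-algebraMap R K n) (algebraMap R K t)) = 2 :=
    QuadraticAlgebra.finrank_eq_two _ _
  let S : Subalgebra R (QuadraticAlgebra K (-algebraMap R K n) (algebraMap R K t)) :=
    (LinearMap.range f).toSubalgebra ⟨m, hfm⟩ fun a b ha hb => by
      obtain ⟨x, rfl⟩ := ha
      obtain ⟨y, rfl⟩ := hb
      exact mul_mem_range_of_norm K hfm hp hφ ht x y
  let e : M ≃ₗ[R] S := LinearEquiv.ofInjective f hf
  have hS : finrank R S = 2 := by rw [← e.finrank_eq, hM]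
  have : Module.Finite R S := .equiv e
  have : NoZeroSMulDivisors R S := e.symm.injective.noZeroSMulDivisors _ (map_zero _) (map_smul _)
  refine ⟨⟨S, hS⟩, e.symm, fun x => ?_⟩
  have hx : (x : QuadraticAlgebra K (-algebraMap R K n) (algebraMap R K t)) = f (e.symm x) :=
    congrArg Subtype.val (e.apply_symm_apply x).symm
  rw [hφ, norm_includeRight_subalgebra K S (by lia) (by rw [hS, hA]) _ x, hx, Algebra.norm_apply,
    ← QuadraticAlgebra.det_toLinearMap_eq_norm]
  · rfl
  rw [eq_top_iff]
  intro a _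
  have ha : a = (a.re - a.im / (f w).im * (f w).re) • f m + (a.im / (f w).im) • f w := by
    rw [hfm]
    ext <;> simp [QuadraticAlgebra.re_one, QuadraticAlgebra.im_one, hw]
  rw [ha]
  exact add_mem (Submodule.smul_mem _ _ (Submodule.subset_span ⟨m, rfl⟩))
    (Submodule.smul_mem _ _ (Submodule.subset_span ⟨w, rfl⟩))

end Lattice

/-- Quadratic algebras over a Dedekind domain `R` are in canonical
bijection with pairs `(M, φ)` where `M` is a rank-2 `R`-lattice and `φ : M → R` is a
quadratic form attaining the value `1`; the bijection is via the norm form. -/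
theorem stmt3 (R : Type u) [CommRing R] [IsDedekindDomain R]
    (K : Type u) [Field K] [Algebra R K] [IsFractionRing R K] :
    (∀ (M : Type u) [AddCommGroup M] [Module R M] [Module.Finite R M]
        [NoZeroSMulDivisors R M], Module.finrank R M = 2 →
      ∀ φ : QuadraticMap R M R, (∃ m, φ m = 1) →
        ∃ (S : QuadAlg R) (e : S.carrier ≃ₗ[R] M), ∀ x : S.carrier,
          algebraMap R K (φ (e x)) =
            Algebra.norm K (Algebra.TensorProduct.includeRight x : K ⊗[R] S.carrier)) ∧
    (∀ S T : QuadAlg R,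
      (∃ e : S.carrier ≃ₗ[R] T.carrier, ∀ x : S.carrier,
          Algebra.norm K (Algebra.TensorProduct.includeRight (e x) : K ⊗[R] T.carrier) =
          Algebra.norm K (Algebra.TensorProduct.includeRight x : K ⊗[R] S.carrier)) →
      Nonempty (S.carrier ≃ₐ[R] T.carrier)) := by
  refine ⟨fun M _ _ _ _ hM φ ⟨m, hm⟩ => ?_, fun S T ⟨e, he⟩ => ?_⟩
  · exact exists_quadAlg_of_map_eq_one K hM φ hm
  · exact nonempty_algEquiv_of_norm K S.rank_eq T.rank_eq e he
end
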